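/- Let (q_n) be a sequence with 0 < q_n < 1 and q_n → 1 as n → ∞, and let x ∈ (0,1). Then lim_{n→∞} [n]_{q_n} · D_{n,q_n}((t-x)_{q_n}²; x) = 2x(1−x). -/

import Mathlib

open Finset Filter Topology

/-- The q-integer `[n]_q = 1 + q + ⋯ + q^(n-1)`. -/
noncomputable def qInt (q : ℝ) (n : ℕ) : ℝ := ∑ i ∈ Finset.range n, q ^ i

/-- The q-factorial `[n]_q!`. -/
noncomputable def qFact (q : ℝ) (n : ℕ) : ℝ := ∏ i ∈ Finset.range n, qInt q (i + 1)

/-- The q-binomial coefficient. -/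
noncomputable def qBinom (q : ℝ) (n k : ℕ) : ℝ := qFact q n / (qFact q k * qFact q (n - k))

/-- `(1 - x)_q^n = ∏_{j=0}^{n-1} (1 - q^j x)`. -/
noncomputable def qOneSubPow (q x : ℝ) (n : ℕ) : ℝ := ∏ j ∈ Finset.range n, (1 - q ^ j * x)

/-- The q-Bernstein basis `p_{nk}(q;x)`. -/
noncomputable def qBern (q : ℝ) (n k : ℕ) (x : ℝ) : ℝ :=
  qBinom q n k * x ^ k * qOneSubPow q x (n - k)

/-- The Jackson q-integral on `[0,1]`. -/
noncomputable def qIntegral (q : ℝ) (g : ℝ → ℝ) : ℝ := (1 - q) * ∑' j : ℕ, q ^ j * g (q ^ j)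

/-- The q-Durrmeyer operator `D_{n,q}(f;x)`. -/
noncomputable def qDurrmeyer (q : ℝ) (n : ℕ) (f : ℝ → ℝ) (x : ℝ) : ℝ :=
  qInt q (n + 1) * ∑ k ∈ Finset.range (n + 1),
    q ^ (-(k : ℤ)) * qBern q n k x * qIntegral q (fun t => f t * qBern q n k (q * t))

/-- The q-Durrmeyer–Stancu operator `D_{n,q}^{α,β}(f;x)`. -/
noncomputable def qDurrmeyerStancu (q : ℝ) (n : ℕ) (α β : ℝ) (f : ℝ → ℝ) (x : ℝ) : ℝ :=
  qDurrmeyer q n (fun t => f ((qInt q n * t + α) / (qInt q n + β))) x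

/-- The q-derivative `D_q f(x) = (f(qx) - f(x)) / ((q-1)x)`. -/
noncomputable def qDeriv (q : ℝ) (f : ℝ → ℝ) (x : ℝ) : ℝ := (f (q * x) - f x) / ((q - 1) * x)

/-- The q-power `(t - x)_q^m = ∏_{j=0}^{m-1} (t - q^j x)`, as a function of `t`. -/
noncomputable def qCentral (q x : ℝ) (m : ℕ) (t : ℝ) : ℝ := ∏ j ∈ Finset.range m, (t - q ^ j * x)

lemma qInt_succ (q : ℝ) (n : ℕ) : qInt q (n + 1) = qInt q n + q ^ n :=
  Finset.sum_range_succ _ _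

lemma qInt_succ' (q : ℝ) (n : ℕ) : qInt q (n + 1) = 1 + q * qInt q n := by
  simp only [qInt, Finset.sum_range_succ', Finset.mul_sum, pow_succ', pow_zero]
  ring

lemma qInt_add (q : ℝ) (m n : ℕ) : qInt q (m + n) = qInt q m + q ^ m * qInt q n := by
  simp only [qInt, Finset.sum_range_add, Finset.mul_sum, pow_add]

lemma qInt_pos {q : ℝ} (hq : 0 < q) (n : ℕ) : 0 < qInt q (n + 1) :=
  Finset.sum_pos (fun _ _ => pow_pos hq _) ⟨0, by simp⟩

lemma one_sub_mul_qInt (q : ℝ) (n : ℕ) : (1 - q) * qInt q n = 1 - q ^ n :=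
  mul_neg_geom_sum q n

lemma qFact_succ (q : ℝ) (n : ℕ) : qFact q (n + 1) = qFact q n * qInt q (n + 1) :=
  Finset.prod_range_succ _ _

lemma qFact_pos {q : ℝ} (hq : 0 < q) (n : ℕ) : 0 < qFact q n :=
  Finset.prod_pos fun _ _ => qInt_pos hq _

lemma qOneSubPow_succ (q x : ℝ) (n : ℕ) :
    qOneSubPow q x (n + 1) = qOneSubPow q x n * (1 - q ^ n * x) :=
  Finset.prod_range_succ _ _

/-- The q-beta integral `∫₀¹ t^a (1 - qt)_q^m d_q t`, as a convergent series. -/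
lemma hasSum_qBeta {q : ℝ} (hq : 0 < q) (hq1 : q < 1) (m a : ℕ) :
    HasSum (fun j : ℕ => (1 - q) * (q ^ j * ((q ^ j) ^ a * qOneSubPow q (q * q ^ j) m)))
      (qFact q a * qFact q m / qFact q (a + m + 1)) := by
  induction m generalizing a with
  | zero =>
    have hlt : q ^ (a + 1) < 1 := pow_lt_one₀ hq.le hq1 (by simp)
    have hI := (qInt_pos hq a).ne'
    have hF := (qFact_pos hq a).ne'
    have hg := (hasSum_geometric_of_lt_one (pow_pos hq (a + 1)).le hlt).mul_left (1 - q)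
    convert hg using 1
    · rfl
    · funext j
      rw [← pow_mul, ← pow_mul]
      simp only [qOneSubPow, Finset.range_zero, Finset.prod_empty, mul_one]
      rw [← pow_add]
      ring_nf
    · have h1 := one_sub_mul_qInt q (a + 1)
      have h2 : 1 - q ^ (a + 1) ≠ 0 := by linarith
      simp only [add_zero, qFact_succ]
      rw [show qFact q 0 = 1 by simp [qFact], ← h1]
      have : 1 - q ≠ 0 := by linarith
      field_simp
  | succ m ih =>
    have h := (ih a).sub ((ih (a + 1)).mul_left (q ^ (m + 1)))
    convert h using 1
    · rfl
    · funext j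
      rw [qOneSubPow_succ]
      ring
    · have hI := (qInt_pos hq (a + m + 1)).ne'
      have hF := (qFact_pos hq (a + m + 1)).ne'
      rw [show a + (m + 1) + 1 = a + m + 1 + 1 by ring,
        show a + 1 + m + 1 = a + m + 1 + 1 by ring, qFact_succ q (a + m + 1), qFact_succ q m,
        qFact_succ q a]
      have hadd := qInt_add q (m + 1) (a + 1)
      rw [show m + 1 + (a + 1) = a + m + 1 + 1 by ring] at hadd
      field_simp
      rw [hadd]
      ring

lemma qBinom_zero_right {q : ℝ} (hq : 0 < q) (n : ℕ) : qBinom q n 0 = 1 := by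
  simp [qBinom, show qFact q 0 = 1 by simp [qFact], (qFact_pos hq n).ne']

lemma qBinom_self {q : ℝ} (hq : 0 < q) (n : ℕ) : qBinom q n n = 1 := by
  simp [qBinom, show qFact q 0 = 1 by simp [qFact], (qFact_pos hq n).ne']

/-- The q-Pascal rule. -/
lemma qBinom_succ_succ {q : ℝ} (hq : 0 < q) {n k : ℕ} (hk : k < n) :
    qBinom q (n + 1) (k + 1) = q ^ (n - k) * qBinom q n k + qBinom q n (k + 1) := by
  obtain ⟨m, rfl⟩ := Nat.exists_eq_add_of_lt hk
  have h1 := (qFact_pos hq k).ne'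
  have h2 := (qFact_pos hq m).ne'
  have h3 := (qInt_pos hq k).ne'
  have h4 := (qInt_pos hq m).ne'
  simp only [qBinom, show k + m + 1 + 1 - (k + 1) = m + 1 by lia,
    show k + m + 1 - k = m + 1 by lia, show k + m + 1 - (k + 1) = m by lia]
  rw [qFact_succ q (k + m + 1), qFact_succ q k, qFact_succ q m,
    show k + m + 1 + 1 = (m + 1) + (k + 1) by ring, qInt_add]
  field_simp
  ring

lemma qBern_succ_succ {q : ℝ} (hq : 0 < q) {n k : ℕ} (hk : k < n) (x : ℝ) :
    qBern q (n + 1) (k + 1) x =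
      (1 - q ^ (n - (k + 1)) * x) * qBern q n (k + 1) x + q ^ (n - k) * x * qBern q n k x := by
  have hb := qBinom_succ_succ hq hk
  obtain ⟨m, rfl⟩ := Nat.exists_eq_add_of_lt hk
  simp only [qBern, hb, show k + m + 1 + 1 - (k + 1) = m + 1 by lia,
    show k + m + 1 - k = m + 1 by lia, show k + m + 1 - (k + 1) = m by lia]
  rw [qOneSubPow_succ]
  ring

lemma sum_qBern_succ {q : ℝ} (hq : 0 < q) (n : ℕ) (x : ℝ) (f : ℕ → ℝ) :
    ∑ k ∈ range (n + 2), qBern q (n + 1) k x * f k =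
      ∑ k ∈ range (n + 1), qBern q n k x * (f k + x * q ^ (n - k) * (f (k + 1) - f k)) := by
  have h0 : qBern q (n + 1) 0 x = (1 - q ^ n * x) * qBern q n 0 x := by
    simp only [qBern, qBinom_zero_right hq, Nat.sub_zero, qOneSubPow_succ]
    ring
  have hn : qBern q (n + 1) (n + 1) x = x * qBern q n n x := by
    simp only [qBern, qBinom_self hq, Nat.sub_self]
    ring
  have hS : ∑ k ∈ range (n + 1), qBern q n k x * (f k + x * q ^ (n - k) * (f (k + 1) - f k)) =
      ∑ k ∈ range (n + 1), (1 - q ^ (n - k) * x) * qBern q n k x * f k +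
        ∑ k ∈ range (n + 1), q ^ (n - k) * x * qBern q n k x * f (k + 1) := by
    rw [← Finset.sum_add_distrib]
    exact Finset.sum_congr rfl fun k _ => by ring
  rw [hS, Finset.sum_range_succ', Finset.sum_range_succ, hn, h0,
    Finset.sum_range_succ' (fun k => (1 - q ^ (n - k) * x) * qBern q n k x * f k),
    Finset.sum_range_succ (fun k => q ^ (n - k) * x * qBern q n k x * f (k + 1)),
    Finset.sum_congr rfl fun k hk => by rw [qBern_succ_succ hq (Finset.mem_range.1 hk), add_mul],
    Finset.sum_add_distrib]
  simp only [Nat.sub_zero, Nat.sub_self]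
  ring

lemma sum_qBern {q : ℝ} (hq : 0 < q) (n : ℕ) (x : ℝ) :
    ∑ k ∈ range (n + 1), qBern q n k x = 1 := by
  induction n with
  | zero => simp [qBern, qBinom_self hq, qOneSubPow]
  | succ n ih => simpa [ih] using sum_qBern_succ hq n x fun _ => 1

lemma sum_qBern_mul_qInt {q : ℝ} (hq : 0 < q) (n : ℕ) (x : ℝ) :
    ∑ k ∈ range (n + 1), qBern q n k x * qInt q k = qInt q n * x := by
  induction n with
  | zero => simp [qInt]
  | succ n ih =>
    rw [sum_qBern_succ hq, qInt_succ q n, add_mul, ← ih, ← mul_one (q ^ n * x),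
      ← sum_qBern hq n x, Finset.mul_sum, ← Finset.sum_add_distrib]
    refine Finset.sum_congr rfl fun k hk => ?_
    rw [qInt_succ, ← pow_sub_mul_pow q (Finset.mem_range_succ_iff.1 hk)]
    ring

lemma sum_qBern_mul_qInt_sq {q : ℝ} (hq : 0 < q) (n : ℕ) (x : ℝ) :
    ∑ k ∈ range (n + 1), qBern q n k x * qInt q k ^ 2 =
      qInt q n ^ 2 * x ^ 2 + qInt q n * x * (1 - x) := by
  induction n with
  | zero => simp [qInt]
  | succ n ih =>
    have h : ∑ k ∈ range (n + 2), qBern q (n + 1) k x * qInt q k ^ 2 =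
        ∑ k ∈ range (n + 1), qBern q n k x * qInt q k ^ 2 +
          x * q ^ n * (∑ k ∈ range (n + 1), qBern q n k x +
            (1 + q) * ∑ k ∈ range (n + 1), qBern q n k x * qInt q k) := by
      rw [sum_qBern_succ hq, Finset.mul_sum, ← Finset.sum_add_distrib, Finset.mul_sum,
        ← Finset.sum_add_distrib]
      refine Finset.sum_congr rfl fun k hk => ?_
      have h1 := qInt_succ q k
      have h2 := qInt_succ' q k
      rw [← pow_sub_mul_pow q (Finset.mem_range_succ_iff.1 hk)]
      have h3 : qInt q (k + 1) ^ 2 - qInt q k ^ 2 = q ^ k * (1 + (1 + q) * qInt q k) := by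
        rw [show q ^ k = qInt q (k + 1) - qInt q k by linarith, h2]
        ring
      rw [h3]
      ring
    rw [h, ih, sum_qBern hq, sum_qBern_mul_qInt hq]
    have h1 := qInt_succ q n
    have h2 := qInt_succ' q n
    rw [show q ^ n = qInt q (n + 1) - qInt q n by linarith, h2]
    ring

lemma hasSum_pow_mul_qBern {q : ℝ} (hq : 0 < q) (hq1 : q < 1) {n k : ℕ} (hk : k ≤ n) (s : ℕ) :
    HasSum (fun j : ℕ => (1 - q) * (q ^ j * ((q ^ j) ^ s * qBern q n k (q * q ^ j))))
      (q ^ k * (qFact q n * qFact q (k + s) / (qFact q k * qFact q (n + s + 1)))) := by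
  have h := (hasSum_qBeta hq hq1 (n - k) (k + s)).mul_left (q ^ k * qBinom q n k)
  have h1 := (qFact_pos hq k).ne'
  have h2 := (qFact_pos hq (n - k)).ne'
  have h3 := (qFact_pos hq (n + s + 1)).ne'
  convert h using 1
  · rfl
  · funext j
    simp only [qBern, mul_pow, pow_add]
    ring
  · rw [show k + s + (n - k) + 1 = n + s + 1 by lia, qBinom]
    field_simp

lemma qIntegral_qCentral_two_mul_qBern {q : ℝ} (hq : 0 < q) (hq1 : q < 1) {n k : ℕ}
    (hk : k ≤ n) (x : ℝ) :
    qInt q (n + 1) * (q ^ (-(k : ℤ)) *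
        qIntegral q (fun t => qCentral q x 2 t * qBern q n k (q * t))) =
      qInt q (k + 1) * qInt q (k + 2) / (qInt q (n + 2) * qInt q (n + 3)) -
        (1 + q) * x * (qInt q (k + 1) / qInt q (n + 2)) + q * x ^ 2 := by
  have h := ((hasSum_pow_mul_qBern hq hq1 hk 2).sub
    ((hasSum_pow_mul_qBern hq hq1 hk 1).mul_left ((1 + q) * x))).add
    ((hasSum_pow_mul_qBern hq hq1 hk 0).mul_left (q * x ^ 2))
  have h1 := (qFact_pos hq k).ne'
  have h2 := (qFact_pos hq n).ne'
  have h3 := (qInt_pos hq n).ne'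
  have h4 := (qInt_pos hq (n + 1)).ne'
  have h5 := (qInt_pos hq (n + 2)).ne'
  have h6 := hq.ne'
  rw [qIntegral, ← tsum_mul_left, tsum_congr fun j => ?_, h.tsum_eq, zpow_neg, zpow_natCast]
  swap
  · simp only [qCentral, Finset.prod_range_succ, Finset.prod_range_zero]
    ring
  simp only [add_zero, qFact_succ]
  field_simp

lemma qDurrmeyer_qCentral_two {q : ℝ} (hq : 0 < q) (hq1 : q < 1) (n : ℕ) (x : ℝ) :
    qDurrmeyer q n (qCentral q x 2) x =
      ((1 + q) + (q + 2 * q ^ 2) * (qInt q n * x) +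
          q ^ 3 * (qInt q n ^ 2 * x ^ 2 + qInt q n * x * (1 - x))) /
          (qInt q (n + 2) * qInt q (n + 3)) -
        (1 + q) * x * ((1 + q * (qInt q n * x)) / qInt q (n + 2)) + q * x ^ 2 := by
  set N2 := qInt q (n + 2)
  set N3 := qInt q (n + 3)
  have h : qDurrmeyer q n (qCentral q x 2) x =
      ((1 + q) / (N2 * N3) - (1 + q) * x / N2 + q * x ^ 2) *
          ∑ k ∈ range (n + 1), qBern q n k x +
        ((q + 2 * q ^ 2) / (N2 * N3) - (1 + q) * x * q / N2) *
          ∑ k ∈ range (n + 1), qBern q n k x * qInt q k +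
        q ^ 3 / (N2 * N3) * ∑ k ∈ range (n + 1), qBern q n k x * qInt q k ^ 2 := by
    simp only [qDurrmeyer, Finset.mul_sum, ← Finset.sum_add_distrib]
    refine Finset.sum_congr rfl fun k hk => ?_
    have hi := qIntegral_qCentral_two_mul_qBern hq hq1 (Finset.mem_range_succ_iff.1 hk) x
    rw [qInt_succ' q (k + 1), qInt_succ' q k] at hi
    trans qBern q n k x * (qInt q (n + 1) * (q ^ (-(k : ℤ)) *
        qIntegral q (fun t => qCentral q x 2 t * qBern q n k (q * t))))
    · ring
    · rw [hi]
      ring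
  rw [h, sum_qBern hq, sum_qBern_mul_qInt hq, sum_qBern_mul_qInt_sq hq]
  ring

lemma tendsto_qInt_atTop {qs : ℕ → ℝ} (hqs : ∀ n, 0 < qs n) (hlim : Tendsto qs atTop (𝓝 1)) :
    Tendsto (fun n => qInt (qs n) n) atTop atTop := by
  refine tendsto_atTop.2 fun b => ?_
  obtain ⟨m, hm⟩ := exists_nat_gt b
  have h : Tendsto (fun n => qInt (qs n) m) atTop (𝓝 (m : ℝ)) := by
    simpa [qInt] using tendsto_finsetSum (range m) fun i _ => hlim.pow i
  filter_upwards [h.eventually_const_lt hm, eventually_ge_atTop m] with n hn hmn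
  exact hn.le.trans (Finset.sum_le_sum_of_subset_of_nonneg (Finset.range_mono hmn)
    fun i _ _ => (pow_pos (hqs n) i).le)

/-- Asymptotics of the second central q-moment. -/
theorem qDurrmeyer_second_central_moment_limit (qs : ℕ → ℝ)
    (hqs : ∀ n, 0 < qs n ∧ qs n < 1) (hlim : Tendsto qs atTop (𝓝 1))
    (x : ℝ) (hx : x ∈ Set.Ioo (0 : ℝ) 1) :
    Tendsto (fun n => qInt (qs n) n * qDurrmeyer (qs n) n (qCentral (qs n) x 2) x)
      atTop (𝓝 (2 * x * (1 - x))) := by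
  have hN := tendsto_qInt_atTop (fun n => (hqs n).1) hlim
  have hu : Tendsto (fun n => (qInt (qs n) n)⁻¹) atTop (𝓝 0) := hN.inv_tendsto_atTop
  have hw : Tendsto (fun n => (1 - qs n) * (1 - qs n ^ n)) atTop (𝓝 0) := by
    have h1 : Tendsto (fun n => 1 - qs n) atTop (𝓝 0) := by simpa using hlim.const_sub 1
    refine squeeze_zero (fun n => ?_) (fun n => ?_) h1
    · exact mul_nonneg (by linarith [(hqs n).2])
        (by linarith [pow_le_one₀ (n := n) (hqs n).1.le (hqs n).2.le])
    · exact mul_le_of_le_one_right (by linarith [(hqs n).2])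
        (by linarith [pow_pos (hqs n).1 n])
  let F : ℝ × ℝ × ℝ → ℝ := fun p =>
    (x ^ 2 * p.1 ^ 3 * (1 + p.1) * p.2.1 +
      (x * (p.1 + 2 * p.1 ^ 2) + p.1 ^ 3 * x * (1 - x) -
        (1 + p.1) * x * (p.1 ^ 3 + p.1 * x * (1 + p.1 + p.1 ^ 2)) +
        p.1 * x ^ 2 * (p.1 ^ 3 * (1 + p.1) + p.1 ^ 2 * (1 + p.1 + p.1 ^ 2))) +
      ((1 + p.1) - (1 + p.1) * x * (1 + p.1 + p.1 ^ 2) +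
        p.1 * x ^ 2 * (1 + p.1) * (1 + p.1 + p.1 ^ 2)) * p.2.2) /
    ((p.1 ^ 2 + (1 + p.1) * p.2.2) * (p.1 ^ 3 + (1 + p.1 + p.1 ^ 2) * p.2.2))
  have hF : ContinuousAt F (1, 0, 0) := by
    refine ContinuousAt.div (by fun_prop) (by fun_prop) (by norm_num)
  have hF0 : F (1, 0, 0) = 2 * x * (1 - x) := by
    simp only [F]
    ring
  rw [← hF0]
  refine (hF.tendsto.comp (hlim.prodMk_nhds (hw.prodMk_nhds hu))).congr' ?_
  filter_upwards [hN.eventually_gt_atTop 0] with n hn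
  obtain ⟨hq, hq1⟩ := hqs n
  have h2 : qInt (qs n) (n + 2) = 1 + qs n + qs n ^ 2 * qInt (qs n) n := by
    rw [qInt_succ', qInt_succ']
    ring
  have h3 : qInt (qs n) (n + 3) = 1 + qs n + qs n ^ 2 + qs n ^ 3 * qInt (qs n) n := by
    rw [qInt_succ', h2]
    ring
  rw [qDurrmeyer_qCentral_two hq hq1, h2, h3]
  simp only [Function.comp, F, ← one_sub_mul_qInt]
  generalize qInt (qs n) n = N at *
  generalize qs n = q at *
  have hp2 : 0 < 1 + q + q ^ 2 * N := by positivity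
  have hp3 : 0 < 1 + q + q ^ 2 + q ^ 3 * N := by positivity
  have e2 : q ^ 2 + (1 + q) * N⁻¹ = (1 + q + q ^ 2 * N) / N := by
    field_simp
    ring
  have e3 : q ^ 3 + (1 + q + q ^ 2) * N⁻¹ = (1 + q + q ^ 2 + q ^ 3 * N) / N := by
    field_simp
    ring
  rw [e2, e3]
  field_simp
  ring
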